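/- Let μ : ℝ^d → ℝ^d be bounded and continuous, let Σ : ℝ^d → ℝ^{d×d} be continuously differentiable with Σ(x) symmetric, ‖Σ‖_∞ < ∞ and ‖∇·Σ‖_∞ < ∞, and let ρ be a strictly positive continuously differentiable probability density on ℝ^d with ‖∇log ρ‖_∞ < ∞. Then for all f, g ∈ C_c^∞(ℝ^d), ⟨L_{μ,Σ}f, g⟩_ρ ≤ [ (‖μ‖_∞ + ½‖∇·Σ‖_∞ + ½‖Σ‖_∞ ‖∇log ρ‖_∞) ‖g‖_ρ + ½ ‖Σ‖_∞ ‖∇g‖_ρ ] · ‖∇f‖_ρ. -/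

import Mathlib

open MeasureTheory Real
open scoped RealInnerProductSpace

/-- The infinitesimal generator `L_{μ,Σ} f = μ·∇f + ½ Σ : ∇²f`. -/
noncomputable def genOp {d : ℕ} (μ : EuclideanSpace ℝ (Fin d) → EuclideanSpace ℝ (Fin d))
    (Sig : EuclideanSpace ℝ (Fin d) → Fin d → Fin d → ℝ)
    (f : EuclideanSpace ℝ (Fin d) → ℝ) (x : EuclideanSpace ℝ (Fin d)) : ℝ :=
  ⟪μ x, gradient f x⟫ +
    (1 / 2) * ∑ i : Fin d, ∑ j : Fin d, Sig x i j *
      fderiv ℝ (fun y => fderiv ℝ f y (EuclideanSpace.single j 1)) x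
        (EuclideanSpace.single i 1)

section Gradient

variable {d : ℕ} {f : EuclideanSpace ℝ (Fin d) → ℝ}

lemma gradient_apply_eq_fderiv_single (f : EuclideanSpace ℝ (Fin d) → ℝ)
    (x : EuclideanSpace ℝ (Fin d)) (i : Fin d) :
    gradient f x i = fderiv ℝ f x (EuclideanSpace.single i 1) := by
  rw [← inner_gradient_left, EuclideanSpace.inner_single_right]
  simp

lemma ContDiff.continuous_gradient (hf : ContDiff ℝ 1 f) : Continuous (gradient f) :=
  (InnerProductSpace.toDual ℝ (EuclideanSpace ℝ (Fin d))).symm.continuous.comp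
    (hf.continuous_fderiv one_ne_zero)

lemma HasCompactSupport.gradient (hf : HasCompactSupport f) :
    HasCompactSupport (gradient f) :=
  (hf.fderiv (𝕜 := ℝ)).comp_left
    (map_zero (InnerProductSpace.toDual ℝ (EuclideanSpace ℝ (Fin d))).symm)

/-- The derivative of `s * g * ρ`, with `ρ` factored out. -/
lemma fderiv_mul_mul_eq_log {s g ρ : EuclideanSpace ℝ (Fin d) → ℝ}
    {x : EuclideanSpace ℝ (Fin d)} (hs : DifferentiableAt ℝ s x) (hg : DifferentiableAt ℝ g x)
    (hρ : DifferentiableAt ℝ ρ x) (hρx : ρ x ≠ 0) (v : EuclideanSpace ℝ (Fin d)) :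
    fderiv ℝ (fun y => s y * g y * ρ y) x v =
      (fderiv ℝ s x v * g x + s x * fderiv ℝ g x v +
        s x * g x * fderiv ℝ (fun y => Real.log (ρ y)) x v) * ρ x := by
  rw [fderiv_fun_mul (hs.fun_mul hg) hρ, fderiv_fun_mul hs hg, fderiv.log hρ hρx]
  simp only [add_apply, smul_apply, smul_eq_mul]
  field_simp
  ring

end Gradient

lemma integral_mul_mul_le_sqrt_mul_sqrt {X : Type*} [TopologicalSpace X] [MeasurableSpace X]
    [OpensMeasurableSpace X] {m : Measure X} [IsFiniteMeasureOnCompacts m]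
    {u v ρ : X → ℝ} (hu : Continuous u) (hv : Continuous v) (hρ : Continuous ρ)
    (hus : HasCompactSupport u) (hvs : HasCompactSupport v)
    (hu0 : ∀ x, 0 ≤ u x) (hv0 : ∀ x, 0 ≤ v x) (hρ0 : ∀ x, 0 ≤ ρ x) :
    ∫ x, u x * v x * ρ x ∂m ≤ √(∫ x, u x ^ 2 * ρ x ∂m) * √(∫ x, v x ^ 2 * ρ x ∂m) := by
  have memLp {w : X → ℝ} (hw : Continuous w) (hws : HasCompactSupport w) :
      MemLp (fun x => w x * √(ρ x)) (ENNReal.ofReal 2) m :=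
    (hw.mul hρ.sqrt).memLp_of_hasCompactSupport hws.mul_right
  have h := integral_mul_le_Lp_mul_Lq_of_nonneg Real.HolderConjugate.two_two
    (.of_forall fun x => mul_nonneg (hu0 x) (Real.sqrt_nonneg (ρ x)))
    (.of_forall fun x => mul_nonneg (hv0 x) (Real.sqrt_nonneg (ρ x)))
    (memLp hu hus) (memLp hv hvs)
  simp only [Real.rpow_two, mul_pow, Real.sq_sqrt (hρ0 _), ← Real.sqrt_eq_rpow] at h
  refine (integral_congr_ae (.of_forall fun x => ?_)).trans_le h
  change u x * v x * ρ x = u x * √(ρ x) * (v x * √(ρ x))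
  linear_combination -(u x * v x) * Real.mul_self_sqrt (hρ0 x)

section SecondOrder

variable {d : ℕ}

lemma integral_mul_fderiv_fderiv_eq {w f : EuclideanSpace ℝ (Fin d) → ℝ}
    (hw : ContDiff ℝ 1 w) (hws : HasCompactSupport w) (hf : ContDiff ℝ 2 f)
    (a b : EuclideanSpace ℝ (Fin d)) :
    ∫ x, w x * fderiv ℝ (fun y => fderiv ℝ f y b) x a =
      -∫ x, fderiv ℝ w x a * fderiv ℝ f x b := by
  have hf' : ContDiff ℝ 1 fun y => fderiv ℝ f y b :=
    (hf.fderiv_right (by norm_num)).clm_apply contDiff_const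
  have hwa : Continuous fun x => fderiv ℝ w x a :=
    (hw.continuous_fderiv one_ne_zero).clm_apply continuous_const
  have hfa : Continuous fun x => fderiv ℝ (fun y => fderiv ℝ f y b) x a :=
    (hf'.continuous_fderiv one_ne_zero).clm_apply continuous_const
  refine integral_mul_fderiv_eq_neg_fderiv_mul_of_integrable ?_ ?_ ?_
    (fun x _ => hw.differentiable one_ne_zero x) (fun x _ => hf'.differentiable one_ne_zero x)
  · exact (hwa.mul hf'.continuous).integrable_of_hasCompactSupport
      (hws.fderiv_apply (𝕜 := ℝ) a).mul_right
  · exact (hw.continuous.mul hfa).integrable_of_hasCompactSupport hws.mul_right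
  · exact (hw.continuous.mul hf'.continuous).integrable_of_hasCompactSupport hws.mul_right

/-- The field `x ↦ Σ(x) ∇f(x)`. -/
noncomputable def matGradient (Sig : EuclideanSpace ℝ (Fin d) → Fin d → Fin d → ℝ)
    (f : EuclideanSpace ℝ (Fin d) → ℝ) (x : EuclideanSpace ℝ (Fin d)) :
    EuclideanSpace ℝ (Fin d) :=
  (WithLp.equiv 2 (Fin d → ℝ)).symm fun i => ∑ j, Sig x i j * gradient f x j

/-- The row-wise divergence `∇·Σ`. -/
noncomputable def matDiv (Sig : EuclideanSpace ℝ (Fin d) → Fin d → Fin d → ℝ)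
    (x : EuclideanSpace ℝ (Fin d)) : EuclideanSpace ℝ (Fin d) :=
  (WithLp.equiv 2 (Fin d → ℝ)).symm fun i =>
    ∑ l, fderiv ℝ (fun y => Sig y i l) x (EuclideanSpace.single l 1)

variable {Sig : EuclideanSpace ℝ (Fin d) → Fin d → Fin d → ℝ}
  {ρ f g : EuclideanSpace ℝ (Fin d) → ℝ}

lemma sum_fderiv_mul_mul_eq (hSig : ∀ i j, ContDiff ℝ 1 fun x => Sig x i j)
    (hSymm : ∀ x i j, Sig x i j = Sig x j i) (hρpos : ∀ x, 0 < ρ x) (hρ : ContDiff ℝ 1 ρ)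
    (hg : ContDiff ℝ 1 g) (x : EuclideanSpace ℝ (Fin d)) :
    ∑ i, ∑ j, fderiv ℝ (fun y => Sig y i j * g y * ρ y) x (EuclideanSpace.single i 1) *
        fderiv ℝ f x (EuclideanSpace.single j 1) =
      (⟪matDiv Sig x, gradient f x⟫ * g x + ⟪matGradient Sig f x, gradient g x⟫ +
        ⟪matGradient Sig f x, gradient (fun y => Real.log (ρ y)) x⟫ * g x) * ρ x := by
  have hdiv : ⟪matDiv Sig x, gradient f x⟫ =
      ∑ i, ∑ j, fderiv ℝ (fun y => Sig y i j) x (EuclideanSpace.single i 1) *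
        fderiv ℝ f x (EuclideanSpace.single j 1) := by
    rw [Finset.sum_comm]
    simp only [matDiv, PiLp.inner_apply, WithLp.equiv_symm_apply, RCLike.inner_apply,
      conj_trivial, gradient_apply_eq_fderiv_single, Finset.mul_sum]
    refine Finset.sum_congr rfl fun j _ => Finset.sum_congr rfl fun i _ => ?_
    simp only [hSymm _ j i]
    ring
  have hmat (h : EuclideanSpace ℝ (Fin d) → ℝ) : ⟪matGradient Sig f x, gradient h x⟫ =
      ∑ i, ∑ j, Sig x i j * fderiv ℝ h x (EuclideanSpace.single i 1) *
        fderiv ℝ f x (EuclideanSpace.single j 1) := by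
    simp only [matGradient, PiLp.inner_apply, WithLp.equiv_symm_apply, RCLike.inner_apply,
      conj_trivial, gradient_apply_eq_fderiv_single, Finset.mul_sum]
    refine Finset.sum_congr rfl fun i _ => Finset.sum_congr rfl fun j _ => ?_
    ring
  rw [hdiv, hmat, hmat]
  simp only [Finset.sum_mul, ← Finset.sum_add_distrib]
  refine Finset.sum_congr rfl fun i _ => Finset.sum_congr rfl fun j _ => ?_
  rw [fderiv_mul_mul_eq_log ((hSig i j).differentiable one_ne_zero x)
    (hg.differentiable one_ne_zero x) (hρ.differentiable one_ne_zero x) (hρpos x).ne']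
  ring

lemma integral_genOp_mul_mul_eq {μ : EuclideanSpace ℝ (Fin d) → EuclideanSpace ℝ (Fin d)}
    (hμ : Continuous μ) (hSig : ∀ i j, ContDiff ℝ 1 fun x => Sig x i j)
    (hSymm : ∀ x i j, Sig x i j = Sig x j i) (hρpos : ∀ x, 0 < ρ x) (hρ : ContDiff ℝ 1 ρ)
    (hf : ContDiff ℝ 2 f) (hg : ContDiff ℝ 1 g) (hgs : HasCompactSupport g) :
    Integrable (fun x => (⟪μ x, gradient f x⟫ * g x - 1 / 2 *
      (⟪matDiv Sig x, gradient f x⟫ * g x + ⟪matGradient Sig f x, gradient g x⟫ +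
        ⟪matGradient Sig f x, gradient (fun y => Real.log (ρ y)) x⟫ * g x)) * ρ x) ∧
    ∫ x, genOp μ Sig f x * g x * ρ x = ∫ x, (⟪μ x, gradient f x⟫ * g x - 1 / 2 *
      (⟪matDiv Sig x, gradient f x⟫ * g x + ⟪matGradient Sig f x, gradient g x⟫ +
        ⟪matGradient Sig f x, gradient (fun y => Real.log (ρ y)) x⟫ * g x)) * ρ x := by
  have hf' (j : Fin d) : ContDiff ℝ 1 fun y => fderiv ℝ f y (EuclideanSpace.single j 1) :=
    (hf.fderiv_right (by norm_num)).clm_apply contDiff_const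
  have hf'' (i j : Fin d) : Continuous fun x =>
      fderiv ℝ (fun y => fderiv ℝ f y (EuclideanSpace.single j 1)) x
        (EuclideanSpace.single i 1) :=
    ((hf' j).continuous_fderiv one_ne_zero).clm_apply continuous_const
  have hw (i j : Fin d) : ContDiff ℝ 1 fun x => Sig x i j * g x * ρ x :=
    ((hSig i j).mul hg).mul hρ
  have hws (i j : Fin d) : HasCompactSupport fun x => Sig x i j * g x * ρ x :=
    (hgs.mul_left (f := fun x => Sig x i j)).mul_right
  have hdrift : Integrable fun x => ⟪μ x, gradient f x⟫ * g x * ρ x :=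
    (((hμ.inner (hf.of_le one_le_two).continuous_gradient).mul hg.continuous).mul
      hρ.continuous).integrable_of_hasCompactSupport
        (hgs.mul_left (f := fun x => ⟪μ x, gradient f x⟫)).mul_right
  have hsecond (i j : Fin d) : Integrable fun x => Sig x i j * g x * ρ x *
      fderiv ℝ (fun y => fderiv ℝ f y (EuclideanSpace.single j 1)) x
        (EuclideanSpace.single i 1) :=
    ((hw i j).continuous.mul (hf'' i j)).integrable_of_hasCompactSupport (hws i j).mul_right
  have hparts (i j : Fin d) : Integrable fun x =>
      fderiv ℝ (fun y => Sig y i j * g y * ρ y) x (EuclideanSpace.single i 1) *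
        fderiv ℝ f x (EuclideanSpace.single j 1) :=
    ((((hw i j).continuous_fderiv one_ne_zero).clm_apply continuous_const).mul
      (hf' j).continuous).integrable_of_hasCompactSupport
        ((hws i j).fderiv_apply (𝕜 := ℝ) _).mul_right
  have hparts_sum := integrable_finsetSum Finset.univ fun i _ =>
    integrable_finsetSum Finset.univ fun j _ => hparts i j
  have hsecond_sum := integrable_finsetSum Finset.univ fun i _ =>
    integrable_finsetSum Finset.univ fun j _ => hsecond i j
  have hright : (fun x => (⟪μ x, gradient f x⟫ * g x - 1 / 2 *
      (⟪matDiv Sig x, gradient f x⟫ * g x + ⟪matGradient Sig f x, gradient g x⟫ +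
        ⟪matGradient Sig f x, gradient (fun y => Real.log (ρ y)) x⟫ * g x)) * ρ x) =
      fun x => ⟪μ x, gradient f x⟫ * g x * ρ x - 1 / 2 * ∑ i, ∑ j,
        fderiv ℝ (fun y => Sig y i j * g y * ρ y) x (EuclideanSpace.single i 1) *
          fderiv ℝ f x (EuclideanSpace.single j 1) := by
    funext x
    rw [sum_fderiv_mul_mul_eq hSig hSymm hρpos hρ hg]
    ring
  have hleft : (fun x => genOp μ Sig f x * g x * ρ x) =
      fun x => ⟪μ x, gradient f x⟫ * g x * ρ x + 1 / 2 * ∑ i, ∑ j, Sig x i j * g x * ρ x *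
        fderiv ℝ (fun y => fderiv ℝ f y (EuclideanSpace.single j 1)) x
          (EuclideanSpace.single i 1) := by
    funext x
    simp only [genOp, add_mul, mul_assoc, Finset.sum_mul]
    congr 2
    refine Finset.sum_congr rfl fun i _ => Finset.sum_congr rfl fun j _ => ?_
    ring
  rw [hright, hleft]
  refine ⟨hdrift.sub (hparts_sum.const_mul _), ?_⟩
  rw [integral_add hdrift (hsecond_sum.const_mul _),
    integral_sub hdrift (hparts_sum.const_mul _), integral_const_mul, integral_const_mul,
    integral_finsetSum _ fun i _ => integrable_finsetSum _ fun j _ => hsecond i j,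
    integral_finsetSum _ fun i _ => integrable_finsetSum _ fun j _ => hparts i j]
  simp only [integral_finsetSum _ fun j _ => hsecond _ j,
    integral_finsetSum _ fun j _ => hparts _ j,
    integral_mul_fderiv_fderiv_eq (hw _ _) (hws _ _) hf, Finset.sum_neg_distrib]
  ring

end SecondOrder

/-- Continuity bound for the generator in weighted `L²` norms
(last inequality of Proposition `lemma:l2 operator`). -/
theorem generator_continuity_bound {d : ℕ} (Bmu BdivSig BSig Blogρ : ℝ)
    (μ : EuclideanSpace ℝ (Fin d) → EuclideanSpace ℝ (Fin d)) (hμ : Continuous μ)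
    (hBmu : ∀ x, ‖μ x‖ ≤ Bmu)
    (Sig : EuclideanSpace ℝ (Fin d) → Fin d → Fin d → ℝ)
    (hSigC1 : ∀ i j, ContDiff ℝ 1 fun x => Sig x i j)
    (hSigSymm : ∀ x i j, Sig x i j = Sig x j i)
    (hBSig : ∀ (x : EuclideanSpace ℝ (Fin d)) (v : EuclideanSpace ℝ (Fin d)),
      ‖(WithLp.equiv 2 (Fin d → ℝ)).symm (fun i => ∑ j, Sig x i j * v j)‖ ≤ BSig * ‖v‖)
    (hBdivSig : ∀ x : EuclideanSpace ℝ (Fin d),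
      ‖(WithLp.equiv 2 (Fin d → ℝ)).symm (fun i =>
        ∑ l, fderiv ℝ (fun y => Sig y i l) x (EuclideanSpace.single l 1))‖ ≤ BdivSig)
    (ρ : EuclideanSpace ℝ (Fin d) → ℝ) (hρpos : ∀ x, 0 < ρ x)
    (hρC1 : ContDiff ℝ 1 ρ) (hρprob : ∫ x, ρ x = 1)
    (hBlogρ : ∀ x, ‖gradient (fun y => Real.log (ρ y)) x‖ ≤ Blogρ)
    (f g : EuclideanSpace ℝ (Fin d) → ℝ)
    (hf : ContDiff ℝ (⊤ : ℕ∞) f) (hfsupp : HasCompactSupport f)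
    (hg : ContDiff ℝ (⊤ : ℕ∞) g) (hgsupp : HasCompactSupport g) :
    ∫ x, genOp μ Sig f x * g x * ρ x ≤
      ((Bmu + (1 / 2) * BdivSig + (1 / 2) * BSig * Blogρ) *
          Real.sqrt (∫ x, g x ^ 2 * ρ x) +
        (1 / 2) * BSig * Real.sqrt (∫ x, ‖gradient g x‖ ^ 2 * ρ x)) *
      Real.sqrt (∫ x, ‖gradient f x‖ ^ 2 * ρ x) := by
  have hf1 : ContDiff ℝ 1 f := hf.of_le (by exact_mod_cast le_top)
  have hf2 : ContDiff ℝ 2 f := contDiff_infty.1 hf 2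
  have hg1 : ContDiff ℝ 1 g := hg.of_le (by exact_mod_cast le_top)
  obtain ⟨hint, heq⟩ := integral_genOp_mul_mul_eq hμ hSigC1 hSigSymm hρpos hρC1 hf2 hg1 hgsupp
  have hGf := hf1.continuous_gradient.norm
  have hGg := hg1.continuous_gradient.norm
  have hint₁ : Integrable fun x => |g x| * ‖gradient f x‖ * ρ x :=
    ((hg1.continuous.abs.mul hGf).mul hρC1.continuous).integrable_of_hasCompactSupport
      hfsupp.gradient.norm.mul_left.mul_right
  have hint₂ : Integrable fun x => ‖gradient g x‖ * ‖gradient f x‖ * ρ x :=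
    ((hGg.mul hGf).mul hρC1.continuous).integrable_of_hasCompactSupport
      hfsupp.gradient.norm.mul_left.mul_right
  have hC₁ := integral_mul_mul_le_sqrt_mul_sqrt (m := volume) hg1.continuous.abs hGf
    hρC1.continuous hgsupp.norm hfsupp.gradient.norm (fun _ => abs_nonneg _)
    (fun _ => norm_nonneg _) (fun x => (hρpos x).le)
  have hC₂ := integral_mul_mul_le_sqrt_mul_sqrt (m := volume) hGg hGf
    hρC1.continuous hgsupp.gradient.norm hfsupp.gradient.norm (fun _ => norm_nonneg _)
    (fun _ => norm_nonneg _) (fun x => (hρpos x).le)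
  simp only [sq_abs] at hC₁
  set C := Bmu + (1 / 2) * BdivSig + (1 / 2) * BSig * Blogρ with hC
  have hbound : ∫ x, genOp μ Sig f x * g x * ρ x ≤
      C * (∫ x, |g x| * ‖gradient f x‖ * ρ x) +
        (1 / 2) * BSig * ∫ x, ‖gradient g x‖ * ‖gradient f x‖ * ρ x := by
    rw [heq, ← integral_const_mul, ← integral_const_mul,
      ← integral_add (hint₁.const_mul _) (hint₂.const_mul _)]
    refine integral_mono hint ((hint₁.const_mul _).add (hint₂.const_mul _)) fun x => ?_
    have hS : ‖matGradient Sig f x‖ ≤ BSig * ‖gradient f x‖ := hBSig x _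
    have hS0 := (norm_nonneg _).trans hS
    have inner_mul_le {a b : EuclideanSpace ℝ (Fin d)} {A B : ℝ} (ha : ‖a‖ ≤ A)
        (hb : ‖b‖ ≤ B) : |⟪a, b⟫| ≤ A * B :=
      (abs_real_inner_le_norm a b).trans
        (mul_le_mul ha hb (norm_nonneg b) ((norm_nonneg a).trans ha))
    have hmul {s A : ℝ} (hs : |s| ≤ A) : |s * g x| ≤ A * |g x| := by
      rw [abs_mul]; gcongr
    have h₁ := (abs_le.1 (hmul (inner_mul_le (hBmu x) (le_refl ‖gradient f x‖)))).2
    have h₂ := (abs_le.1 (hmul (inner_mul_le (a := matDiv Sig x) (hBdivSig x) (le_refl ‖gradient f x‖)))).1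
    have h₃ := (abs_le.1 (inner_mul_le hS (le_refl ‖gradient g x‖))).1
    have h₄ := (abs_le.1 (hmul (inner_mul_le hS (hBlogρ x)))).1
    change _ * ρ x ≤ C * (_ * ρ x) + 1 / 2 * BSig * (_ * ρ x)
    rw [← mul_assoc, ← mul_assoc (1 / 2 * BSig), ← add_mul]
    refine mul_le_mul_of_nonneg_right ?_ (hρpos x).le
    rw [hC]
    linarith
  rcases isEmpty_or_nonempty (Fin d) with hd | ⟨⟨i⟩⟩
  · have hz (h : EuclideanSpace ℝ (Fin d) → ℝ) (x) : ‖gradient h x‖ = 0 := by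
      rw [Subsingleton.elim (gradient h x) 0, norm_zero]
    simpa [hz] using hbound
  · have hBSig0 : 0 ≤ BSig := by
      simpa using (norm_nonneg _).trans (hBSig 0 (EuclideanSpace.single i 1))
    have hC0 : 0 ≤ C := by
      have h₁ := (norm_nonneg _).trans (hBmu 0)
      have h₂ := (norm_nonneg _).trans (hBdivSig 0)
      have h₃ := (norm_nonneg _).trans (hBlogρ 0)
      positivity
    calc _ ≤ _ := hbound
      _ ≤ _ := add_le_add (mul_le_mul_of_nonneg_left hC₁ hC0)
        (mul_le_mul_of_nonneg_left hC₂ (by positivity))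
      _ = _ := by ring
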